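/- arXiv:2206.08770 — 2 statements merged into one kernel-verified Lean document; each statement's English description precedes it below -/
import Mathlib

section
/- Let n ≥ 11 be an integer and let h be a field of symmetric n×n matrices on ℝⁿ with homogeneous quadratic polynomial entries that is trace-free, divergence-free, and satisfies ∑_{j=1}^n x_j h_{ij}(x) = 0 for all x and i. Then for every t > 0 and z ∈ ℝⁿ one has ∫_{ℝⁿ} ∑_{p,q=1}^n h_{pq}(x) ∂_p B_{t,z}(x) ∂_q B_{t,z}(x) dx = 0. -/
open MeasureTheory Real

noncomputable section

/-- The Euclidean space `ℝⁿ`. -/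
abbrev En (n : ℕ) := EuclideanSpace ℝ (Fin n)

/-- Partial derivative in the `i`-th coordinate direction. -/
noncomputable def pd {n : ℕ} (i : Fin n) (f : En n → ℝ) (x : En n) : ℝ :=
  fderiv ℝ f x (EuclideanSpace.single i 1)

/-- The standard bubble `B_{t,z}(x) = t^{(n-2)/2} (t² + |x-z|²/(n(n-2)))^{-(n-2)/2}`. -/
noncomputable def Bub (n : ℕ) (t : ℝ) (z x : En n) : ℝ :=
  t ^ (((n : ℝ) - 2) / 2) *
    (t ^ 2 + ‖x - z‖ ^ 2 / ((n : ℝ) * ((n : ℝ) - 2))) ^ (-(((n : ℝ) - 2) / 2))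

theorem pd_Bub {n : ℕ} (hn : 2 < n) {t : ℝ} (ht : 0 < t) (z x : En n) (p : Fin n) :
    pd p (Bub n t z) x =
      -(t ^ (((n : ℝ) - 2) / 2) / n) *
        (t ^ 2 + ‖x - z‖ ^ 2 / ((n : ℝ) * ((n : ℝ) - 2))) ^ (-((n : ℝ) / 2)) * (x - z) p := by
  have h2 : (2 : ℝ) < n := by exact_mod_cast hn
  have h3 : (0 : ℝ) < n - 2 := by linarith
  have hpos : 0 < t ^ 2 + ‖x - z‖ ^ 2 / ((n : ℝ) * ((n : ℝ) - 2)) := by positivity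
  have h1 : HasFDerivAt (fun y : En n => y - z) (ContinuousLinearMap.id ℝ (En n)) x :=
    (hasFDerivAt_id x).sub_const z
  simp only [div_eq_mul_inv _ ((n : ℝ) * ((n : ℝ) - 2))] at hpos
  have h4 := (((h1.norm_sq.mul_const ((n : ℝ) * ((n : ℝ) - 2))⁻¹).const_add (t ^ 2)).rpow_const
    (p := -(((n : ℝ) - 2) / 2)) (Or.inl hpos.ne')).const_mul (t ^ (((n : ℝ) - 2) / 2))
  unfold pd Bub
  simp only [div_eq_mul_inv _ ((n : ℝ) * ((n : ℝ) - 2))]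
  rw [h4.fderiv, show -(((n : ℝ) - 2) / 2) - 1 = -((n : ℝ) / 2) by ring]
  generalize (t ^ 2 + ‖x - z‖ ^ 2 * ((n : ℝ) * ((n : ℝ) - 2))⁻¹) ^ (-((n : ℝ) / 2)) = w
  simp [EuclideanSpace.inner_single_right]
  field_simp

/-- The square of the radial profile of the gradient of the bubble, up to a constant. -/
noncomputable def radialWeight (n : ℕ) (t : ℝ) (y : En n) : ℝ :=
  ((t ^ 2 + ‖y‖ ^ 2 / ((n : ℝ) * ((n : ℝ) - 2))) ^ (-((n : ℝ) / 2))) ^ 2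

theorem integrable_mul_radialWeight {n : ℕ} (hn : 2 < n) {t : ℝ} (ht : 0 < t) (p q : Fin n) :
    Integrable fun y : En n => y p * y q * radialWeight n t y := by
  have h2 : (2 : ℝ) < n := by exact_mod_cast hn
  have h3 : (0 : ℝ) < n - 2 := by linarith
  set c : ℝ := min (t ^ 2) (1 / ((n : ℝ) * ((n : ℝ) - 2))) with hc
  have hc0 : 0 < c := by positivity
  have hlow (y : En n) :
      c * (1 + ‖y‖ ^ 2) ≤ t ^ 2 + ‖y‖ ^ 2 / ((n : ℝ) * ((n : ℝ) - 2)) := by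
    have e1 : c ≤ t ^ 2 := min_le_left _ _
    have e2 : c * ‖y‖ ^ 2 ≤ 1 / ((n : ℝ) * ((n : ℝ) - 2)) * ‖y‖ ^ 2 := by
      gcongr
      exact min_le_right _ _
    rw [one_div_mul_eq_div] at e2
    linarith
  have hint : Integrable fun y : En n =>
      c ^ (-(n : ℝ)) * (1 + ‖y‖ ^ 2) ^ (-(2 * (n : ℝ) - 2) / 2) := by
    apply Integrable.const_mul
    apply integrable_rpow_neg_one_add_norm_sq
    rw [finrank_euclideanSpace_fin]
    linarith
  refine hint.mono' ?_ (ae_of_all _ fun y => ?_)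
  · unfold radialWeight
    apply Measurable.aestronglyMeasurable
    fun_prop
  · have hu : 0 < t ^ 2 + ‖y‖ ^ 2 / ((n : ℝ) * ((n : ℝ) - 2)) := by positivity
    have hw : radialWeight n t y ≤ c ^ (-(n : ℝ)) * (1 + ‖y‖ ^ 2) ^ (-(n : ℝ)) := by
      rw [← Real.mul_rpow hc0.le (by positivity), radialWeight, ← Real.rpow_mul_natCast hu.le]
      rw [show -((n : ℝ) / 2) * (2 : ℕ) = -(n : ℝ) by push_cast; ring]
      exact Real.rpow_le_rpow_of_nonpos (by positivity) (hlow y) (by linarith)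
    have hy : |y p| * |y q| ≤ 1 + ‖y‖ ^ 2 := by
      have e1 : |y p| ≤ ‖y‖ := PiLp.norm_apply_le y p
      have e2 : |y q| ≤ ‖y‖ := PiLp.norm_apply_le y q
      nlinarith [mul_le_mul e1 e2 (abs_nonneg _) (norm_nonneg _)]
    have hw0 : 0 ≤ radialWeight n t y := sq_nonneg _
    rw [Real.norm_eq_abs, abs_mul, abs_mul, abs_of_nonneg hw0]
    calc |y p| * |y q| * radialWeight n t y
        ≤ (1 + ‖y‖ ^ 2) * (c ^ (-(n : ℝ)) * (1 + ‖y‖ ^ 2) ^ (-(n : ℝ))) := by gcongr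
      _ = c ^ (-(n : ℝ)) * (1 + ‖y‖ ^ 2) ^ (-(2 * (n : ℝ) - 2) / 2) := by
        rw [show -(2 * (n : ℝ) - 2) / 2 = -(n : ℝ) + 1 by ring,
          Real.rpow_add_one (by positivity)]
        ring

theorem integral_comp_linearIsometryEquiv {n : ℕ} (e : En n ≃ₗᵢ[ℝ] En n) (f : En n → ℝ) :
    ∫ y, f (e y) = ∫ y, f y :=
  e.measurePreserving.integral_comp e.toHomeomorph.measurableEmbedding f

theorem radialWeight_isometry {n : ℕ} (t : ℝ) (e : En n ≃ₗᵢ[ℝ] En n) (y : En n) :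
    radialWeight n t (e y) = radialWeight n t y := by
  simp [radialWeight]

theorem integral_mul_radialWeight_of_ne {n : ℕ} (t : ℝ) {p q : Fin n} (hpq : p ≠ q) :
    ∫ y : En n, y p * y q * radialWeight n t y = 0 := by
  let e : En n ≃ₗᵢ[ℝ] En n := LinearIsometryEquiv.piLpCongrRight 2
    fun i => if i = p then LinearIsometryEquiv.neg ℝ else LinearIsometryEquiv.refl ℝ ℝ
  have hp (y : En n) : e y p = -y p := by simp [e]
  have hq (y : En n) : e y q = y q := by simp [e, hpq.symm]
  have := integral_comp_linearIsometryEquiv e fun y => y p * y q * radialWeight n t y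
  simp only [hp, hq, radialWeight_isometry, neg_mul, integral_neg] at this
  linarith

theorem integral_sq_mul_radialWeight_eq {n : ℕ} (t : ℝ) (p q : Fin n) :
    ∫ y : En n, y p * y p * radialWeight n t y = ∫ y : En n, y q * y q * radialWeight n t y := by
  let e : En n ≃ₗᵢ[ℝ] En n := LinearIsometryEquiv.piLpCongrLeft 2 ℝ ℝ (Equiv.swap p q)
  have hp (y : En n) : e y p = y q := by simp [e, LinearIsometryEquiv.piLpCongrLeft_apply]
  have := integral_comp_linearIsometryEquiv e fun y => y p * y p * radialWeight n t y
  simpa only [hp, radialWeight_isometry] using this.symm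

/-- A trace-free quadratic form integrates to zero against a radial weight. -/
theorem integral_quadratic_mul_radialWeight {n : ℕ} (hn : 2 < n) {t : ℝ} (ht : 0 < t)
    (a : Fin n → Fin n → ℝ) (ha : ∑ j, a j j = 0) :
    ∫ y : En n, (∑ p, ∑ q, a p q * y p * y q) * radialWeight n t y = 0 := by
  have hI (p q : Fin n) :
      Integrable fun y : En n => a p q * (y p * y q * radialWeight n t y) :=
    (integrable_mul_radialWeight hn ht p q).const_mul _
  let o : Fin n := ⟨0, by omega⟩
  calc ∫ y : En n, (∑ p, ∑ q, a p q * y p * y q) * radialWeight n t y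
      = ∫ y : En n, ∑ p, ∑ q, a p q * (y p * y q * radialWeight n t y) := by
        simp only [Finset.sum_mul, mul_assoc]
    _ = ∑ p, ∑ q, a p q * ∫ y : En n, y p * y q * radialWeight n t y := by
        rw [integral_finsetSum _ fun p _ => integrable_finsetSum _ fun q _ => hI p q]
        simp only [integral_finsetSum _ fun q _ => hI _ q, integral_const_mul]
    _ = ∑ p, a p p * ∫ y : En n, y o * y o * radialWeight n t y := by
        refine Finset.sum_congr rfl fun p _ => ?_
        rw [Finset.sum_eq_single p, integral_sq_mul_radialWeight_eq t p o]
        · intro q _ hq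
          rw [integral_mul_radialWeight_of_ne t hq.symm, mul_zero]
        · simp
    _ = 0 := by rw [← Finset.sum_mul, ha, zero_mul]

/-- An integral vanishes as soon as the integral of the even part does. -/
theorem integral_eq_zero_of_even_part {n : ℕ} (f : En n → ℝ)
    (hf : ∫ y, (f y + f (-y)) = 0) : ∫ y, f y = 0 := by
  by_cases hi : Integrable f
  · rw [integral_add hi hi.comp_neg, integral_neg_eq_self f volume] at hf
    linarith
  · exact integral_undef hi

theorem stmt3 (n : ℕ) (hn : 11 ≤ n) (h : En n → Fin n → Fin n → ℝ)
    -- `h(x)` is a symmetric matrix for every `x`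
    (hsymm : ∀ x i j, h x i j = h x j i)
    -- the entries of `h` are homogeneous quadratic polynomials
    (hpoly : ∀ i j, ∃ c : Fin n → Fin n → ℝ,
      ∀ x : En n, h x i j = ∑ p, ∑ q, c p q * x p * x q)
    -- `h` is trace-free
    (htr : ∀ x : En n, ∑ j, h x j j = 0)
    -- `h` is divergence-free
    (hdiv : ∀ (x : En n) (i : Fin n), ∑ j, pd j (fun y => h y j i) x = 0)
    -- `∑_j x_j h_{ij}(x) = 0` for all `x` and `i`
    (hrad : ∀ (x : En n) (i : Fin n), ∑ j, x j * h x i j = 0)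
    (t : ℝ) (ht : 0 < t) (z : En n) :
    ∫ x : En n, ∑ p, ∑ q, h x p q * pd p (Bub n t z) x * pd q (Bub n t z) x = 0 := by
  have hn2 : 2 < n := by omega
  set K : ℝ := -(t ^ (((n : ℝ) - 2) / 2) / n) with hK
  have hpar (y : En n) (p q : Fin n) :
      h (y + z) p q + h (-y + z) p q = 2 * h y p q + 2 * h z p q := by
    obtain ⟨c, hc⟩ := hpoly p q
    simp only [hc, Finset.mul_sum, ← Finset.sum_add_distrib, PiLp.add_apply, PiLp.neg_apply]
    exact Finset.sum_congr rfl fun _ _ => Finset.sum_congr rfl fun _ _ => by ring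
  have hzero (y : En n) : ∑ p, ∑ q, h y p q * y p * y q = 0 := by
    refine Finset.sum_eq_zero fun p _ => ?_
    rw [← mul_zero (y p), ← hrad y p, Finset.mul_sum]
    exact Finset.sum_congr rfl fun _ _ => by ring
  rw [← integral_add_right_eq_self _ z]
  apply integral_eq_zero_of_even_part
  rw [← mul_zero (2 * K ^ 2),
    ← integral_quadratic_mul_radialWeight hn2 ht (h z) (htr z), ← integral_const_mul]
  congr 1 with y
  simp only [pd_Bub hn2 ht, add_sub_cancel_right, norm_neg, PiLp.neg_apply, ← hK]
  have hrw := add_zero (∑ p, ∑ q, h z p q * y p * y q)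
  rw [← hzero y] at hrw
  rw [← hrw]
  simp only [radialWeight, Finset.sum_mul, Finset.mul_sum, ← Finset.sum_add_distrib, add_mul,
    mul_add]
  refine Finset.sum_congr rfl fun p _ => Finset.sum_congr rfl fun q _ => ?_
  generalize (t ^ 2 + ‖y‖ ^ 2 / ((n : ℝ) * ((n : ℝ) - 2))) ^ (-((n : ℝ) / 2)) = w
  linear_combination (K ^ 2 * w ^ 2 * y p * y q) * hpar y p q
end
end

section
/- Let n ≥ 11 be an integer and let h be a field of symmetric n×n matrices on ℝⁿ with homogeneous quadratic polynomial entries that is trace-free, divergence-free, and satisfies ∑_{j=1}^n x_j h_{ij}(x) = 0 for all x and i. For t > 0 and z ∈ ℝⁿ define V₀(y) = (|y|²/(n(n−2)) − 1)(1 + |y|²/(n(n−2)))^{−n/2}, V_j(y) = y_j (1 + |y|²/(n(n−2)))^{−n/2} for 1 ≤ j ≤ n, and Z_{j,t,z}(x) = t^{1−n/2} V_j((x−z)/t) for 0 ≤ j ≤ n. Then for every 0 ≤ j ≤ n one has ∫_{ℝⁿ} Z_{j,t,z}(x) · ∑_{p,q=1}^n h_{pq}(x) ∂²_{pq}B_{t,z}(x)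 dx = 0. -/
open MeasureTheory Real

noncomputable section

/-- `V₀(y) = (|y|²/(n(n-2)) - 1)(1 + |y|²/(n(n-2)))^{-n/2}`. -/
noncomputable def V0 (n : ℕ) (y : En n) : ℝ :=
  (‖y‖ ^ 2 / ((n : ℝ) * ((n : ℝ) - 2)) - 1) *
    (1 + ‖y‖ ^ 2 / ((n : ℝ) * ((n : ℝ) - 2))) ^ (-((n : ℝ) / 2))

/-- `V_j(y) = y_j (1 + |y|²/(n(n-2)))^{-n/2}` for `1 ≤ j ≤ n`. -/
noncomputable def Vj (n : ℕ) (j : Fin n) (y : En n) : ℝ :=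
  y j * (1 + ‖y‖ ^ 2 / ((n : ℝ) * ((n : ℝ) - 2))) ^ (-((n : ℝ) / 2))

/-- `Z_{0,t,z}(x) = t^{1-n/2} V₀((x-z)/t)`. -/
noncomputable def Z0 (n : ℕ) (t : ℝ) (z x : En n) : ℝ :=
  t ^ (1 - (n : ℝ) / 2) * V0 n (t⁻¹ • (x - z))

/-- `Z_{j,t,z}(x) = t^{1-n/2} V_j((x-z)/t)` for `1 ≤ j ≤ n`. -/
noncomputable def Zj (n : ℕ) (j : Fin n) (t : ℝ) (z x : En n) : ℝ :=
  t ^ (1 - (n : ℝ) / 2) * Vj n j (t⁻¹ • (x - z))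

/-! ### Integrals killed by averaging over isometries -/

/-- If the average of `F` over finitely many linear isometries vanishes pointwise, then `∫ F = 0`.
No integrability is needed: the integral of a non-integrable function is zero by convention. -/
lemma integral_eq_zero_of_sum_comp_isometry {n : ℕ} {ι : Type*} [Fintype ι] [Nonempty ι]
    (σ : ι → (En n ≃ₗᵢ[ℝ] En n)) (F : En n → ℝ) (hF : ∀ y, ∑ i, F (σ i y) = 0) :
    ∫ y, F y = 0 := by
  by_cases hint : Integrable F
  · have hcomp : ∀ i, ∫ y, F (σ i y) = ∫ y, F y := fun i =>
      (σ i).measurePreserving.integral_comp (σ i).toHomeomorph.measurableEmbedding F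
    have hsum : ∑ i, ∫ y, F (σ i y) = 0 := by
      rw [← integral_finsetSum]
      · simp [hF]
      · intro i _
        exact (σ i).measurePreserving.integrable_comp_of_integrable hint
    simpa [hcomp] using hsum
  · exact integral_undef hint

lemma integral_eq_zero_of_odd {n : ℕ} (F : En n → ℝ) (hF : ∀ y, F (-y) = -F y) :
    ∫ y, F y = 0 := by
  have h := integral_neg_eq_self F volume
  simp only [hF, integral_neg] at h
  linarith

/-- The isometry `y ↦ (ε_k y_{k+a})_k` of `ℝⁿ`. -/
def signShift {n : ℕ} [NeZero n] (ε : Fin n → ℤˣ) (a : Fin n) : En n ≃ₗᵢ[ℝ] En n :=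
  (LinearIsometryEquiv.piLpCongrLeft 2 ℝ ℝ (Equiv.subRight a)).trans
    (LinearIsometryEquiv.piLpCongrRight 2 fun k =>
      if ε k = 1 then LinearIsometryEquiv.refl ℝ ℝ else LinearIsometryEquiv.neg ℝ)

lemma signShift_apply {n : ℕ} [NeZero n] (ε : Fin n → ℤˣ) (a : Fin n) (y : En n) (k : Fin n) :
    signShift ε a y k = ((ε k : ℤ) : ℝ) * y (k + a) := by
  rcases Int.units_eq_one_or (ε k) with h | h <;>
    simp [signShift, h, Equiv.piCongrLeft'_apply]

lemma sum_signs_mul_of_ne {n : ℕ} {k l : Fin n} (hkl : k ≠ l) :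
    ∑ ε : Fin n → ℤˣ, ((ε k : ℤ) : ℝ) * ((ε l : ℤ) : ℝ) = 0 := by
  have h := Equiv.sum_comp (Equiv.mulRight (Pi.mulSingle k (-1) : Fin n → ℤˣ))
    (fun ε : Fin n → ℤˣ => ((ε k : ℤ) : ℝ) * ((ε l : ℤ) : ℝ))
  simp [Pi.mulSingle_eq_of_ne hkl.symm] at h
  linarith

lemma sum_signs_mul {n : ℕ} (k l : Fin n) :
    ∑ ε : Fin n → ℤˣ, ((ε k : ℤ) : ℝ) * ((ε l : ℤ) : ℝ) = if k = l then 2 ^ n else 0 := by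
  split_ifs with h
  · subst h
    have h1 : ∀ u : ℤˣ, ((u : ℤ) : ℝ) * ((u : ℤ) : ℝ) = 1 := fun u => by
      rcases Int.units_eq_one_or u with h | h <;> simp [h]
    simp [h1]
  · exact sum_signs_mul_of_ne h

/-- A radial weight times a trace-free quadratic form integrates to zero. -/
lemma integral_radial_mul_traceless_quadratic {n : ℕ} [NeZero n] (f : En n → ℝ)
    (hf : ∀ y y', ‖y‖ = ‖y'‖ → f y = f y') (M : Fin n → Fin n → ℝ) (hM : ∑ k, M k k = 0) :
    ∫ y : En n, f y * ∑ k, ∑ l, M k l * y k * y l = 0 := by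
  refine integral_eq_zero_of_sum_comp_isometry
    (fun i : Fin n × (Fin n → ℤˣ) => signShift i.2 i.1) _ fun y => ?_
  have hfy : ∀ i : Fin n × (Fin n → ℤˣ), f (signShift i.2 i.1 y) = f y := fun i =>
    hf _ _ (LinearIsometryEquiv.norm_map _ _)
  simp only [hfy, signShift_apply, ← Finset.mul_sum]
  refine mul_eq_zero_of_right _ ?_
  rw [Fintype.sum_prod_type]
  have inner_sum : ∀ a : Fin n, ∑ ε : Fin n → ℤˣ, ∑ k, ∑ l,
      M k l * (((ε k : ℤ) : ℝ) * y (k + a)) * (((ε l : ℤ) : ℝ) * y (l + a)) =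
      2 ^ n * ∑ k, M k k * y (k + a) ^ 2 := by
    intro a
    rw [Finset.sum_comm, Finset.mul_sum]
    refine Finset.sum_congr rfl fun k _ => ?_
    rw [Finset.sum_comm]
    have : ∀ l, ∑ ε : Fin n → ℤˣ,
        M k l * (((ε k : ℤ) : ℝ) * y (k + a)) * (((ε l : ℤ) : ℝ) * y (l + a)) =
        if k = l then 2 ^ n * (M k l * y (k + a) * y (l + a)) else 0 := by
      intro l
      have h := congrArg (fun s => M k l * y (k + a) * y (l + a) * s) (sum_signs_mul k l)
      simp only [Finset.mul_sum] at h
      rw [mul_ite, mul_zero, mul_comm _ ((2 : ℝ) ^ n)] at h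
      rw [← h]
      exact Finset.sum_congr rfl fun ε _ => by ring
    simp only [this, Finset.sum_ite_eq, Finset.mem_univ, if_true]
    ring
  simp only [inner_sum, ← Finset.mul_sum]
  refine mul_eq_zero_of_right _ ?_
  rw [Finset.sum_comm]
  have shift : ∀ k : Fin n, ∑ a, M k k * y (k + a) ^ 2 = M k k * ∑ a, y a ^ 2 := by
    intro k
    rw [← Finset.mul_sum]
    exact congrArg _ (Equiv.sum_comp (Equiv.addLeft k) fun a => y a ^ 2)
  simp only [shift, ← Finset.sum_mul, hM, zero_mul]

/-! ### Derivatives of the bubble -/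

lemma hasFDerivAt_add_norm_sq_rpow {n : ℕ} {t c : ℝ} (ht : 0 < t) (hc : 0 < c) (r : ℝ)
    (z x : En n) :
    HasFDerivAt (fun y : En n => (t ^ 2 + ‖y - z‖ ^ 2 / c) ^ r)
      ((r * (t ^ 2 + ‖x - z‖ ^ 2 / c) ^ (r - 1) * (2 / c)) • innerSL ℝ (x - z)) x := by
  have h1 : HasFDerivAt (fun y : En n => t ^ 2 + ‖y - z‖ ^ 2 / c)
      ((2 / c) • innerSL ℝ (x - z)) x := by
    have h := ((((hasFDerivAt_id x).sub_const z).norm_sq).mul_const c⁻¹).const_add (t ^ 2)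
    simp only [div_eq_mul_inv]
    refine h.congr_fderiv ?_
    ext v
    simp
    ring
  have hpos : 0 < t ^ 2 + ‖x - z‖ ^ 2 / c := by positivity
  refine (h1.rpow_const (p := r) (Or.inl hpos.ne')).congr_fderiv ?_
  rw [smul_smul]

lemma pd_pd_Bub {n : ℕ} (hn : 2 < n) {t : ℝ} (ht : 0 < t) (z : En n) :
    ∃ a b : En n → ℝ, (∀ y y', ‖y‖ = ‖y'‖ → a y = a y') ∧ ∀ (x : En n) (p q : Fin n),
      pd p (fun y => pd q (Bub n t z) y) x =
        a (x - z) * ((x - z) p * (x - z) q) + if p = q then b (x - z) else 0 := by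
  have hn' : (2 : ℝ) < n := by exact_mod_cast hn
  obtain ⟨c, hc⟩ : ∃ c : ℝ, c = (n : ℝ) * ((n : ℝ) - 2) := ⟨_, rfl⟩
  obtain ⟨m, hm⟩ : ∃ m : ℝ, m = -(((n : ℝ) - 2) / 2) := ⟨_, rfl⟩
  obtain ⟨A, hA⟩ : ∃ A : ℝ, A = t ^ (((n : ℝ) - 2) / 2) := ⟨_, rfl⟩
  have hc0 : 0 < c := by rw [hc]; exact mul_pos (by linarith) (by linarith)
  have first : ∀ (q : Fin n) (x : En n), pd q (Bub n t z) x =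
      A * m * (2 / c) * ((t ^ 2 + ‖x - z‖ ^ 2 / c) ^ (m - 1) * (x - z) q) := by
    intro q x
    have h : HasFDerivAt (Bub n t z) _ x :=
      (hasFDerivAt_add_norm_sq_rpow ht (hc ▸ hc0) m z x).const_mul A |>.congr_of_eventuallyEq
        (Filter.Eventually.of_forall fun y => by simp only [Bub, hA, hm])
    rw [pd, h.fderiv]
    simp [EuclideanSpace.inner_single_right, ← hc]
    ring
  refine ⟨fun y => A * m * (2 / c) * ((m - 1) * (t ^ 2 + ‖y‖ ^ 2 / c) ^ (m - 1 - 1) * (2 / c)),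
    fun y => A * m * (2 / c) * (t ^ 2 + ‖y‖ ^ 2 / c) ^ (m - 1),
    fun y y' h => by simp only [h], fun x p q => ?_⟩
  simp only [first]
  have hcoord : HasFDerivAt (fun y : En n => (y - z) q) (EuclideanSpace.proj q : En n →L[ℝ] ℝ) x :=
    ((EuclideanSpace.proj q : En n →L[ℝ] ℝ).hasFDerivAt.sub_const (z q))
  have h := ((hasFDerivAt_add_norm_sq_rpow ht hc0 (m - 1) z x).mul hcoord).const_mul
    (A * m * (2 / c))
  rw [pd]
  erw [h.fderiv]
  by_cases hpq : p = q
  · subst hpq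
    simp [EuclideanSpace.inner_single_right]
    ring
  · simp [EuclideanSpace.inner_single_right, hpq, Ne.symm hpq]
    ring

/-! ### Algebra of the quadratic field -/

/-- Polarization of the quadratic form with coefficients `c`. -/
def polarForm {n : ℕ} (c : Fin n → Fin n → ℝ) (x y : En n) : ℝ :=
  ∑ k, ∑ l, c k l * (x k * y l + y k * x l)

lemma quadratic_add_smul {n : ℕ} (c : Fin n → Fin n → ℝ) (x y : En n) (s : ℝ) :
    ∑ k, ∑ l, c k l * (x + s • y) k * (x + s • y) l =
      (∑ k, ∑ l, c k l * x k * x l) + s * polarForm c x y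
        + s ^ 2 * ∑ k, ∑ l, c k l * y k * y l := by
  simp only [polarForm, Finset.mul_sum, ← Finset.sum_add_distrib]
  refine Finset.sum_congr rfl fun k _ => Finset.sum_congr rfl fun l _ => ?_
  simp
  ring

lemma polarForm_comm {n : ℕ} (c : Fin n → Fin n → ℝ) (x y : En n) :
    polarForm c x y = polarForm c y x := by
  simp only [polarForm, add_comm]

lemma pd_quadratic {n : ℕ} (c : Fin n → Fin n → ℝ) (j : Fin n) (x : En n) :
    pd j (fun y => ∑ k, ∑ l, c k l * y k * y l) x =
      polarForm c x (EuclideanSpace.single j 1) := by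
  have hdiff : DifferentiableAt ℝ (fun y : En n => ∑ k, ∑ l, c k l * y k * y l) x := by fun_prop
  rw [pd, ← hdiff.lineDeriv_eq_fderiv]
  refine HasLineDerivAt.lineDeriv ?_
  simp only [HasLineDerivAt, quadratic_add_smul]
  have h := (((hasDerivAt_id (0 : ℝ)).mul_const
    (polarForm c x (EuclideanSpace.single j 1))).const_add
    (∑ k, ∑ l, c k l * x k * x l)).fun_add (((hasDerivAt_id (0 : ℝ)).fun_pow 2).mul_const
      (∑ k, ∑ l, c k l * (EuclideanSpace.single j (1 : ℝ) : En n) k *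
        (EuclideanSpace.single j (1 : ℝ) : En n) l))
  simpa using h

/-- First-order part of `∑_j x_j h_{ij}(x) = 0` at `x` in the direction `y`. -/
lemma polarized_radial {n : ℕ} {c : Fin n → Fin n → Fin n → Fin n → ℝ}
    (hrad : ∀ (x : En n) (i : Fin n), ∑ j, x j * ∑ k, ∑ l, c i j k l * x k * x l = 0)
    (x y : En n) (i : Fin n) :
    ∑ j, (y j * (∑ k, ∑ l, c i j k l * x k * x l) + x j * polarForm (c i j) x y) = 0 := by
  have h1 := hrad (x + (1 : ℝ) • y) i
  have h2 := hrad (x + (-1 : ℝ) • y) i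
  have h3 := hrad y i
  simp only [quadratic_add_smul] at h1 h2
  have key : ∑ j, (y j * (∑ k, ∑ l, c i j k l * x k * x l) + x j * polarForm (c i j) x y) =
      (1 / 2) * (∑ j, (x + (1 : ℝ) • y) j * ((∑ k, ∑ l, c i j k l * x k * x l)
          + 1 * polarForm (c i j) x y + 1 ^ 2 * ∑ k, ∑ l, c i j k l * y k * y l)
        - ∑ j, (x + (-1 : ℝ) • y) j * ((∑ k, ∑ l, c i j k l * x k * x l)
          + -1 * polarForm (c i j) x y + (-1) ^ 2 * ∑ k, ∑ l, c i j k l * y k * y l))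
        - ∑ j, y j * ∑ k, ∑ l, c i j k l * y k * y l := by
    rw [← Finset.sum_sub_distrib, Finset.mul_sum, ← Finset.sum_sub_distrib]
    refine Finset.sum_congr rfl fun j _ => ?_
    simp
    ring
  rw [key, h1, h2, h3]
  ring

/-- Contracting `h(y+z)` twice with `y` gives the quadratic form `h(y)` contracted with `z`. -/
lemma contract_shift {n : ℕ} {c : Fin n → Fin n → Fin n → Fin n → ℝ}
    (hsymm : ∀ (x : En n) i j,
      ∑ k, ∑ l, c i j k l * x k * x l = ∑ k, ∑ l, c j i k l * x k * x l)
    (hrad : ∀ (x : En n) (i : Fin n), ∑ j, x j * ∑ k, ∑ l, c i j k l * x k * x l = 0)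
    (x z : En n) :
    ∑ p, ∑ q, (∑ k, ∑ l, c p q k l * x k * x l) * ((x - z) p * (x - z) q) =
      ∑ p, ∑ q, z p * z q * ∑ k, ∑ l, c p q k l * (x - z) k * (x - z) l := by
  obtain ⟨y, rfl⟩ : ∃ y, x = z + (1 : ℝ) • y := ⟨x - z, by simp⟩
  set x := z + (1 : ℝ) • y with hx
  have hy : x - z = y := by simp [hx]
  rw [hy]
  let H : En n → Fin n → Fin n → ℝ := fun x i j => ∑ k, ∑ l, c i j k l * x k * x l
  have hH : ∀ p q, H x p q = H z p q + polarForm (c p q) z y + H y p q := fun p q => by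
    simp only [H, hx, quadratic_add_smul]; ring
  have hyx : ∀ p, y p = x p - z p := fun p => by simp [hx]
  have right_rad : ∀ (w : En n) (p : Fin n), ∑ q, H w p q * w q = 0 := fun w p => by
    rw [← hrad w p]; exact Finset.sum_congr rfl fun q _ => mul_comm _ _
  have left_rad : ∀ (w : En n) (q : Fin n), ∑ p, H w p q * w p = 0 := fun w q => by
    rw [← right_rad w q]
    exact Finset.sum_congr rfl fun p _ => by rw [show H w p q = H w q p from hsymm w p q]
  have toz : ∑ p, ∑ q, H x p q * (y p * y q) = ∑ p, ∑ q, H x p q * (z p * z q) := by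
    have e : ∀ p q, H x p q * (y p * y q) =
        H x p q * (z p * z q) + y p * (H x p q * x q) - z q * (H x p q * x p) := fun p q => by
      rw [hyx, hyx]; ring
    simp only [e, Finset.sum_add_distrib, Finset.sum_sub_distrib, ← Finset.mul_sum, right_rad]
    have : ∑ p, ∑ q, z q * (H x p q * x p) = 0 := by
      rw [Finset.sum_comm]
      simp only [← Finset.mul_sum, left_rad, mul_zero, Finset.sum_const_zero]
    rw [this]; simp
  have polar_zero : ∑ p, ∑ q, polarForm (c p q) z y * (z p * z q) = 0 := by
    have h0 : ∑ p, z p * ∑ q, (y q * H z p q + z q * polarForm (c p q) z y) = 0 :=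
      Finset.sum_eq_zero fun p _ => mul_eq_zero_of_right _ (polarized_radial hrad z y p)
    have e : ∑ p, z p * ∑ q, (y q * H z p q + z q * polarForm (c p q) z y) =
        (∑ p, ∑ q, y q * (H z p q * z p)) + ∑ p, ∑ q, polarForm (c p q) z y * (z p * z q) := by
      simp only [Finset.mul_sum, ← Finset.sum_add_distrib]
      exact Finset.sum_congr rfl fun p _ => Finset.sum_congr rfl fun q _ => by ring
    have e2 : ∑ p, ∑ q, y q * (H z p q * z p) = 0 := by
      rw [Finset.sum_comm]
      simp only [← Finset.mul_sum, left_rad, mul_zero, Finset.sum_const_zero]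
    linarith
  have hz_zero : ∑ p, ∑ q, H z p q * (z p * z q) = 0 := by
    refine Finset.sum_eq_zero fun p _ => ?_
    have := congrArg (fun s => z p * s) (right_rad z p)
    simp only [Finset.mul_sum, mul_zero] at this
    rw [← this]
    exact Finset.sum_congr rfl fun q _ => by ring
  change ∑ p, ∑ q, H x p q * (y p * y q) = ∑ p, ∑ q, z p * z q * H y p q
  rw [toz]
  simp only [hH, add_mul, Finset.sum_add_distrib, polar_zero, hz_zero, zero_add]
  exact Finset.sum_congr rfl fun p _ => Finset.sum_congr rfl fun q _ => mul_comm _ _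

lemma quadratic_single {n : ℕ} (c : Fin n → Fin n → ℝ) (k : Fin n) :
    ∑ i, ∑ l, c i l * (EuclideanSpace.single k (1 : ℝ) : En n) i *
      (EuclideanSpace.single k (1 : ℝ) : En n) l = c k k := by
  simp [PiLp.single_apply]

/-- The entries of a divergence-free field with `∑_j x_j h_{ij}(x) = 0` are trace-free as
quadratic forms, i.e. harmonic. -/
lemma sum_diag_eq_zero {n : ℕ} {c : Fin n → Fin n → Fin n → Fin n → ℝ}
    (hdiv : ∀ (x : En n) (i : Fin n),
      ∑ j, polarForm (c i j) x (EuclideanSpace.single j 1) = 0)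
    (hrad : ∀ (x : En n) (i : Fin n), ∑ j, x j * ∑ k, ∑ l, c i j k l * x k * x l = 0)
    (p q : Fin n) : ∑ k, c p q k k = 0 := by
  have h : ∀ k, c p q k k +
      polarForm (c p k) (EuclideanSpace.single q 1) (EuclideanSpace.single k 1) = 0 := by
    intro k
    have := polarized_radial hrad (EuclideanSpace.single k 1) (EuclideanSpace.single q 1) p
    simp only [quadratic_single, Finset.sum_add_distrib] at this
    simpa [PiLp.single_apply, polarForm_comm _ (EuclideanSpace.single k 1)] using this
  have hs := Finset.sum_eq_zero fun k (_ : k ∈ Finset.univ) => h k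
  rwa [Finset.sum_add_distrib, hdiv, add_zero] at hs

theorem stmt4 (n : ℕ) (hn : 11 ≤ n) (h : En n → Fin n → Fin n → ℝ)
    -- `h(x)` is a symmetric matrix for every `x`
    (hsymm : ∀ x i j, h x i j = h x j i)
    -- the entries of `h` are homogeneous quadratic polynomials
    (hpoly : ∀ i j, ∃ c : Fin n → Fin n → ℝ,
      ∀ x : En n, h x i j = ∑ p, ∑ q, c p q * x p * x q)
    -- `h` is trace-free
    (htr : ∀ x : En n, ∑ j, h x j j = 0)
    -- `h` is divergence-free
    (hdiv : ∀ (x : En n) (i : Fin n), ∑ j, pd j (fun y => h y j i) x = 0)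
    -- `∑_j x_j h_{ij}(x) = 0` for all `x` and `i`
    (hrad : ∀ (x : En n) (i : Fin n), ∑ j, x j * h x i j = 0)
    (t : ℝ) (ht : 0 < t) (z : En n) :
    (∫ x : En n,
        Z0 n t z x * ∑ p, ∑ q, h x p q * pd p (fun y => pd q (Bub n t z) y) x) = 0 ∧
      ∀ j : Fin n,
        (∫ x : En n,
          Zj n j t z x * ∑ p, ∑ q, h x p q * pd p (fun y => pd q (Bub n t z) y) x) = 0 := by
  have : NeZero n := ⟨by omega⟩
  choose c hc using hpoly
  have hrad' : ∀ (x : En n) (i : Fin n), ∑ j, x j * ∑ k, ∑ l, c i j k l * x k * x l = 0 := by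
    intro x i; simpa only [hc] using hrad x i
  have hsymm' : ∀ (x : En n) i j,
      ∑ k, ∑ l, c i j k l * x k * x l = ∑ k, ∑ l, c j i k l * x k * x l := by
    intro x i j; simpa only [hc] using hsymm x i j
  have hdiv' : ∀ (x : En n) (i : Fin n),
      ∑ j, polarForm (c i j) x (EuclideanSpace.single j 1) = 0 := by
    intro x i
    rw [← hdiv x i]
    refine Finset.sum_congr rfl fun j _ => ?_
    simp only [hsymm _ j i, hc, pd_quadratic]
  obtain ⟨a, b, ha, hab⟩ := pd_pd_Bub (by omega : 2 < n) ht z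
  let M : Fin n → Fin n → ℝ := fun k l => ∑ p, ∑ q, z p * z q * c p q k l
  have hM : ∑ k, M k k = 0 := by
    simp only [M]
    rw [Finset.sum_comm]
    refine Finset.sum_eq_zero fun p _ => ?_
    rw [Finset.sum_comm]
    refine Finset.sum_eq_zero fun q _ => ?_
    rw [← Finset.mul_sum, sum_diag_eq_zero hdiv' hrad', mul_zero]
  have hcontract : ∀ x : En n,
      ∑ p, ∑ q, h x p q * pd p (fun y => pd q (Bub n t z) y) x =
        a (x - z) * ∑ k, ∑ l, M k l * (x - z) k * (x - z) l := by
    intro x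
    have hMform : ∑ k, ∑ l, M k l * (x - z) k * (x - z) l =
        ∑ p, ∑ q, z p * z q * ∑ k, ∑ l, c p q k l * (x - z) k * (x - z) l := by
      simp only [M, Finset.sum_mul, Finset.mul_sum]
      rw [Finset.sum_congr rfl fun k _ => Finset.sum_comm, Finset.sum_comm]
      refine Finset.sum_congr rfl fun p _ => ?_
      rw [Finset.sum_congr rfl fun k _ => Finset.sum_comm, Finset.sum_comm]
      refine Finset.sum_congr rfl fun q _ => Finset.sum_congr rfl fun k _ =>
        Finset.sum_congr rfl fun l _ => ?_
      ring
    rw [hMform, ← contract_shift hsymm' hrad' x z]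
    have htrace : ∑ p, ∑ q, (if p = q then h x p q * b (x - z) else 0) = 0 := by
      simp [← Finset.sum_mul, htr]
    simp only [hab, mul_add, mul_ite, mul_zero, Finset.sum_add_distrib, htrace, add_zero,
      Finset.mul_sum, ← hc]
    exact Finset.sum_congr rfl fun p _ => Finset.sum_congr rfl fun q _ => by ring
  simp only [hcontract, Z0, Zj]
  constructor
  · rw [integral_sub_right_eq_self (fun y : En n => t ^ (1 - (n : ℝ) / 2) * V0 n (t⁻¹ • y) *
      (a y * ∑ k, ∑ l, M k l * y k * y l)) z]
    simp only [← mul_assoc (_ * V0 n _)]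
    refine integral_radial_mul_traceless_quadratic _ (fun y y' hy => ?_) M hM
    simp only [V0, norm_smul, hy, ha y y' hy]
  · intro j
    rw [integral_sub_right_eq_self (fun y : En n => t ^ (1 - (n : ℝ) / 2) * Vj n j (t⁻¹ • y) *
      (a y * ∑ k, ∑ l, M k l * y k * y l)) z]
    refine integral_eq_zero_of_odd _ fun y => ?_
    simp [Vj, ha (-y) y (norm_neg y)]
end
end
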